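/- arXiv:2208.00224 — 2 statements merged into one kernel-verified Lean document; each statement's English description precedes it below -/
import Mathlib

section
/- Let d ≥ 2 and let R be a real d×d matrix with all diagonal entries equal to 1 satisfying Assumptions (A1) and (A2), and assume det R = 0. Then there exists a vector a ∈ ℝ^d with all coordinates strictly positive such that the row vector relation a·R = 0 holds (equivalently, Rᵀ·a = 0). -/
open Matrix Filter

/-- A real matrix `R` is an S-matrix if there exists a vector `x ≥ 0`
(coordinatewise) with `R.mulVec x > 0` (coordinatewise). -/
def IsSMatrix {n : Type*} [Fintype n] (R : Matrix n n ℝ) : Prop :=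
  ∃ x : n → ℝ, (∀ i, 0 ≤ x i) ∧ ∀ i, 0 < R.mulVec x i

/-- Assumption (A1): `R` is not an S-matrix. -/
def AssumptionA1 {d : ℕ} (R : Matrix (Fin d) (Fin d) ℝ) : Prop :=
  ¬ IsSMatrix R

/-- Assumption (A2): every principal submatrix of `R` indexed by a nonempty
proper subset of `{1,…,d}` is an S-matrix. -/
def AssumptionA2 {d : ℕ} (R : Matrix (Fin d) (Fin d) ℝ) : Prop :=
  ∀ I : Finset (Fin d), I.Nonempty → I ≠ Finset.univ →
    IsSMatrix (R.submatrix (fun i : I => (i : Fin d)) (fun i : I => (i : Fin d)))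


lemma ville_aux {d : ℕ} (R : Matrix (Fin d) (Fin d) ℝ) (h : ¬ IsSMatrix R) :
    ∃ a : Fin d → ℝ, (∀ i, 0 ≤ a i) ∧ a ≠ 0 ∧ ∀ j, (Rᵀ.mulVec a) j ≤ 0 := by
  set P : Set (Fin d → ℝ) := Set.univ.pi fun _ => Set.Ioi (0 : ℝ) with hP
  set T : Set (Fin d → ℝ) := Set.image R.mulVecLin (Set.univ.pi fun _ => Set.Ici (0 : ℝ)) with hT
  have hPc : Convex ℝ P := convex_pi fun _ _ => convex_Ioi 0
  have hPo : IsOpen P := isOpen_set_pi Set.finite_univ fun _ _ => isOpen_Ioi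
  have hTc : Convex ℝ T := (convex_pi fun _ _ => convex_Ici 0).linear_image _
  have hdis : Disjoint P T := by
    rw [Set.disjoint_left]
    rintro y hy ⟨x, hx, rfl⟩
    exact h ⟨x, fun i => hx i trivial, fun i => hy i trivial⟩
  obtain ⟨f, u, hf1, hf2⟩ := geometric_hahn_banach_open hPc hPo hTc hdis
  have hu : u ≤ 0 := by
    have := hf2 0 ⟨0, fun i _ => by simp, by simp⟩
    simpa using this
  have hrep : ∀ y : Fin d → ℝ, f y = ∑ i, y i * f (Pi.single i 1) := by
    intro y
    conv_lhs => rw [pi_eq_sum_univ' y]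
    simp [map_sum]
  have hone : f 1 < 0 := (hf1 1 fun i _ => by simp).trans_le hu
  refine ⟨fun i => - f (Pi.single i 1), ?_, ?_, ?_⟩
  · intro i
    by_contra! hc
    have hc' : 0 < f (Pi.single i 1) := by simpa using hc
    have ht : 0 ≤ -f 1 / f (Pi.single i 1) := by
      apply div_nonneg <;> linarith
    have := hf1 (1 + (-f 1 / f (Pi.single i 1)) • Pi.single i 1) (by
      intro j _
      have : 0 ≤ (Pi.single i (1 : ℝ) : Fin d → ℝ) j := by
        by_cases hij : j = i
        · subst hij; simp
        · simp [hij]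
      have := mul_nonneg ht this
      simp only [Set.mem_Ioi, Pi.add_apply, Pi.one_apply, Pi.smul_apply, smul_eq_mul]
      linarith)
    rw [map_add, map_smul, smul_eq_mul, div_mul_cancel₀ _ hc'.ne'] at this
    linarith
  · intro h0
    have : f 1 = 0 := by
      rw [hrep]
      apply Finset.sum_eq_zero
      intro i _
      have := congrFun h0 i
      simp at this
      simp [this]
    linarith
  · intro j
    by_contra! hc
    set v := f (R.mulVec (Pi.single j 1)) with hv
    have hv0 : v < 0 := by
      have e : (Rᵀ.mulVec fun i => - f (Pi.single i 1)) j = - v := by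
        rw [hv, hrep]
        simp [Matrix.mulVec, dotProduct, Matrix.transpose_apply, Pi.single_apply]
      linarith
    have hs : 0 ≤ (u - 1) / v := div_nonneg_of_nonpos (by linarith) hv0.le
    have := hf2 (((u - 1) / v) • R.mulVec (Pi.single j 1))
      ⟨((u - 1) / v) • Pi.single j 1, fun i _ => by
        by_cases hij : i = j
        · subst hij; simpa using hs
        · simp [hij], by
        rw [map_smul]; rfl⟩
    rw [map_smul, smul_eq_mul, ← hv, div_mul_cancel₀ _ hv0.ne] at this
    linarith

lemma full_support_aux {d : ℕ} (R : Matrix (Fin d) (Fin d) ℝ) (hA2 : AssumptionA2 R)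
    (a : Fin d → ℝ) (ha : ∀ i, 0 ≤ a i) (ha0 : a ≠ 0) (hR : ∀ j, (Rᵀ.mulVec a) j ≤ 0) :
    ∀ i, 0 < a i := by
  classical
  by_contra! hc
  obtain ⟨k, hk⟩ := hc
  set I : Finset (Fin d) := Finset.univ.filter fun i => 0 < a i with hI
  have hne : I.Nonempty := by
    obtain ⟨i, hi⟩ := Function.ne_iff.mp ha0
    exact ⟨i, by simpa [hI] using lt_of_le_of_ne (ha i) (Ne.symm hi)⟩
  have hpr : I ≠ Finset.univ := by
    intro h
    have : k ∈ I := h ▸ Finset.mem_univ k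
    simp [hI] at this
    linarith
  obtain ⟨x, hx, hRx⟩ := hA2 I hne hpr
  have h1 : 0 < ∑ i : I, a i * ∑ j : I, R i j * x j := by
    apply Finset.sum_pos
    · intro i _
      exact mul_pos (Finset.mem_filter.mp i.2).2 (hRx i)
    · obtain ⟨i, hi⟩ := hne
      exact ⟨⟨i, hi⟩, Finset.mem_univ _⟩
  have h2 : ∑ i : I, a i * ∑ j : I, R i j * x j = ∑ j : I, (Rᵀ.mulVec a) j * x j := by
    simp_rw [Finset.mul_sum]
    rw [Finset.sum_comm]
    refine Finset.sum_congr rfl fun j _ => ?_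
    have : (Rᵀ.mulVec a) j = ∑ i : I, R i j * a i := by
      rw [Finset.sum_coe_sort I (fun i => R i j * a i)]
      simp only [Matrix.mulVec, dotProduct, Matrix.transpose_apply]
      symm
      apply Finset.sum_subset (Finset.subset_univ _)
      intro i _ hi
      have : a i ≤ 0 := by simpa [hI] using hi
      rw [le_antisymm this (ha i), mul_zero]
    rw [this, Finset.sum_mul]
    exact Finset.sum_congr rfl fun i _ => by ring
  have h3 : ∑ j : I, (Rᵀ.mulVec a) j * x j ≤ 0 :=
    Finset.sum_nonpos fun j _ => mul_nonpos_of_nonpos_of_nonneg (hR j) (hx j)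
  linarith

theorem stmt_3 {d : ℕ} (hd : 2 ≤ d) (R : Matrix (Fin d) (Fin d) ℝ)
    (hdiag : ∀ i, R i i = 1) (hA1 : AssumptionA1 R) (hA2 : AssumptionA2 R)
    (hdet : R.det = 0) :
    ∃ a : Fin d → ℝ, (∀ i, 0 < a i) ∧ Rᵀ.mulVec a = 0 := by
  classical
  obtain ⟨a, ha, ha0, hR⟩ := ville_aux R hA1
  have hpos := full_support_aux R hA2 a ha ha0 hR
  refine ⟨a, hpos, ?_⟩
  obtain ⟨w, hw0, hw, k, hk⟩ : ∃ w : Fin d → ℝ, w ≠ 0 ∧ Rᵀ.mulVec w = 0 ∧ ∃ k, w k < 0 := by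
    obtain ⟨w, hw0, hw⟩ := Matrix.exists_mulVec_eq_zero_iff.mpr
      (show Rᵀ.det = 0 by rw [Matrix.det_transpose, hdet])
    obtain ⟨i, hi⟩ := Function.ne_iff.mp hw0
    rcases lt_or_gt_of_ne hi with h | h
    · exact ⟨w, hw0, hw, i, h⟩
    · exact ⟨-w, neg_ne_zero.mpr hw0, by rw [Matrix.mulVec_neg, hw, neg_zero], i, by simpa using h⟩
  obtain ⟨m, hm, hmin⟩ := Finset.exists_min_image (Finset.univ.filter fun i => w i < 0)
    (fun i => a i / (-w i)) ⟨k, by simpa using hk⟩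
  have hm' : w m < 0 := by simpa using hm
  set t := a m / (-w m) with ht
  have ht0 : 0 ≤ t := div_nonneg (ha m) (by linarith)
  have hker : Rᵀ.mulVec (a + t • w) = Rᵀ.mulVec a := by
    rw [Matrix.mulVec_add, Matrix.mulVec_smul, hw, smul_zero, add_zero]
  have hbm : (a + t • w) m = 0 := by
    simp only [Pi.add_apply, Pi.smul_apply, smul_eq_mul, ht]
    have := hm'.ne
    field_simp
    ring
  have hb : ∀ i, 0 ≤ (a + t • w) i := by
    intro i
    simp only [Pi.add_apply, Pi.smul_apply, smul_eq_mul]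
    by_cases hi : w i < 0
    · have := hmin i (by simpa using hi)
      rw [le_div_iff₀ (by linarith)] at this
      linarith
    · have := mul_nonneg ht0 (not_lt.mp hi)
      linarith [ha i]
  by_cases hz : a + t • w = 0
  · rw [← hker, hz, Matrix.mulVec_zero]
  · have := full_support_aux R hA2 _ hb hz (by rw [hker]; exact hR) m
    linarith
end

section
/- Let d ≥ 2, let R be a real d×d matrix with all diagonal entries equal to 1 satisfying Assumptions (A1) and (A2), and assume det R = 0. Let Σ be a symmetric positive definite real d×d matrix and let μ ∈ ℝ^d have all coordinates strictly positive. Then there exists a vector a ∈ ℝ^d with all coordinates strictly negative and Rᵀ·a = 0 such that the function f : ℝ^d → ℝ defined by f(x) = exp(⟨a, x⟩) satisfies: (i) (1/2)·∑_{i,j} Σ_{ij} ∂²f/∂x_i∂x_j (x) + ∑_i μ_i ∂f/∂x_i (x) = 0 for all x ∈ ℝ^d; (ii) for every i ∈ {1,…,d} and every x in the orthant ℝ₊^d with x_i = 0, one has ∑_k r_{ki} ∂f/∂x_k (x) = 0 (Neumann condition with respect to the i-th column of R); (iii) f(0) = 1; and (iv) f(x) → 0 as |x| → ∞ with x ranging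 in ℝ₊^d. -/
open Matrix Filter

theorem aux_ville {d : ℕ} (hd : 0 < d) (R : Matrix (Fin d) (Fin d) ℝ) (h : ¬ IsSMatrix R) :
    ∃ y : Fin d → ℝ, (∀ i, 0 ≤ y i) ∧ y ≠ 0 ∧ ∀ j, (Rᵀ.mulVec y) j ≤ 0 := by
  classical
  let P : Set (Fin d → ℝ) := Set.pi Set.univ (fun _ => Set.Ioi 0)
  let K : Set (Fin d → ℝ) := Set.image (fun x => R.mulVec x) {x | ∀ i, 0 ≤ x i}
  have hPo : IsOpen P := isOpen_set_pi Set.finite_univ (fun _ _ => isOpen_Ioi)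
  have hPc : Convex ℝ P := convex_pi (fun _ _ => convex_Ioi 0)
  have hKc : Convex ℝ K := by
    have : Convex ℝ {x : Fin d → ℝ | ∀ i, 0 ≤ x i} := by
      intro x hx y hy s t hs ht _ i
      have := hx i
      have := hy i
      simp only [Pi.add_apply, Pi.smul_apply, smul_eq_mul]
      positivity
    exact this.linear_image R.mulVecLin
  have hdis : Disjoint P K := by
    rw [Set.disjoint_left]
    rintro _ hp ⟨x, hx, rfl⟩
    exact h ⟨x, hx, fun i => hp i trivial⟩
  obtain ⟨f, u, hf1, hf2⟩ := geometric_hahn_banach_open hPc hPo hKc hdis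
  have hu : u ≤ 0 := by
    have := hf2 0 ⟨0, fun _ => le_rfl, by simp⟩
    simpa using this
  have h1 : f 1 < u := hf1 _ (fun i _ => by simp)
  have hexp : ∀ v : Fin d → ℝ, f v = ∑ i, v i * f (Pi.single i 1) := by
    intro v
    conv_lhs => rw [pi_eq_sum_univ' v]
    simp [map_sum]
  refine ⟨fun i => - f (Pi.single i 1), ?_, ?_, ?_⟩
  · intro i
    by_contra hc
    have hc : 0 < f (Pi.single i 1) := by linarith
    have ht : 0 < (-f 1) / f (Pi.single i 1) := div_pos (by linarith) hc
    have := hf1 (((-f 1) / f (Pi.single i 1)) • Pi.single i 1 + 1) (fun k _ => by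
      have : (0:ℝ) ≤ (Pi.single i 1 : Fin d → ℝ) k := by
        by_cases hk : k = i
        · subst hk; simp
        · simp [hk]
      simp only [Set.mem_Ioi, Pi.add_apply, Pi.smul_apply, smul_eq_mul, Pi.one_apply]
      positivity)
    rw [map_add, map_smul, smul_eq_mul, div_mul_cancel₀ _ hc.ne'] at this
    linarith
  · intro h0
    have : f 1 = 0 := by
      rw [hexp]
      apply Finset.sum_eq_zero
      intro i _
      have := congrFun h0 i
      simp at this
      simp [this]
    linarith
  · intro j
    have hj : (Rᵀ.mulVec fun i => - f (Pi.single i 1)) j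
        = - f (R.mulVec (Pi.single j 1)) := by
      rw [hexp]
      simp [Matrix.mulVec, dotProduct, Pi.single_apply]
    rw [hj]
    by_contra hc
    set c := f (R.mulVec (Pi.single j 1)) with hcdef
    have hc : c < 0 := by linarith
    have ht : 0 < (f 1) / c := div_pos_of_neg_of_neg (by linarith) hc
    have := hf2 _ ⟨((f 1) / c) • Pi.single j 1, (fun k => by
      have : (0:ℝ) ≤ (Pi.single j 1 : Fin d → ℝ) k := by
        by_cases hk : k = j
        · subst hk; simp
        · simp [hk]
      simp only [Pi.smul_apply, smul_eq_mul]
      positivity), rfl⟩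
    simp only [Matrix.mulVec_smul, map_smul, smul_eq_mul] at this
    rw [← hcdef, div_mul_cancel₀ _ hc.ne] at this
    linarith

theorem aux_pos {d : ℕ} (R : Matrix (Fin d) (Fin d) ℝ) (hA2 : AssumptionA2 R)
    (y : Fin d → ℝ) (h0 : ∀ i, 0 ≤ y i) (hne : y ≠ 0)
    (hle : ∀ j, (Rᵀ.mulVec y) j ≤ 0) : ∀ i, 0 < y i := by
  classical
  by_contra hc
  push Not at hc
  obtain ⟨k, hk⟩ := hc
  let I : Finset (Fin d) := Finset.univ.filter (fun i => 0 < y i)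
  have hI : I.Nonempty := by
    obtain ⟨i, hi⟩ := Function.ne_iff.mp hne
    exact ⟨i, by simp [I]; exact lt_of_le_of_ne (h0 i) (Ne.symm hi)⟩
  have hI' : I ≠ Finset.univ := by
    intro h
    have : k ∈ I := h ▸ Finset.mem_univ k
    simp [I] at this
    linarith
  obtain ⟨x, hx, hRx⟩ := hA2 I hI hI'
  have e1 : 0 < ∑ i : I, y i * (R.submatrix (fun i : I => (i : Fin d))
      (fun i : I => (i : Fin d))).mulVec x i := by
    have : Nonempty I := hI.to_subtype
    apply Finset.sum_pos
    · intro i _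
      have : 0 < y i := (Finset.mem_filter.mp i.2).2
      exact mul_pos this (hRx i)
    · exact Finset.univ_nonempty
  have e2 : ∑ i : I, y i * (R.submatrix (fun i : I => (i : Fin d))
      (fun i : I => (i : Fin d))).mulVec x i = ∑ j : I, x j * (Rᵀ.mulVec y) j := by
    have : ∀ j, (Rᵀ.mulVec y) j = ∑ i : I, R i j * y i := by
      intro j
      rw [Finset.sum_coe_sort I (fun i => R i j * y i)]
      simp only [Matrix.mulVec, dotProduct, Matrix.transpose_apply]
      symm
      apply Finset.sum_subset (Finset.subset_univ _)
      intro i _ hi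
      have : y i = 0 := by
        simp [I] at hi
        exact le_antisymm hi (h0 i)
      simp [this]
    simp only [this]
    simp only [Matrix.mulVec, dotProduct, Matrix.submatrix_apply, Finset.mul_sum]
    rw [Finset.sum_comm]
    refine Finset.sum_congr rfl fun _ _ => Finset.sum_congr rfl fun _ _ => by ring
  have e3 : ∑ j : I, x j * (Rᵀ.mulVec y) j ≤ 0 :=
    Finset.sum_nonpos fun j _ => mul_nonpos_of_nonneg_of_nonpos (hx j) (hle j)
  linarith

theorem aux_kernel {d : ℕ} (hd : 0 < d) (R : Matrix (Fin d) (Fin d) ℝ)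
    (hA1 : AssumptionA1 R) (hA2 : AssumptionA2 R) (hdet : R.det = 0) :
    ∃ y : Fin d → ℝ, (∀ i, 0 < y i) ∧ Rᵀ.mulVec y = 0 := by
  classical
  obtain ⟨y, h0, hne, hle⟩ := aux_ville hd R hA1
  have hy := aux_pos R hA2 y h0 hne hle
  obtain ⟨z', hz', hRz'⟩ := Matrix.exists_mulVec_eq_zero_iff.mpr
    (show Rᵀ.det = 0 by rw [Matrix.det_transpose, hdet])
  obtain ⟨z, hRz, k0, hk0⟩ : ∃ z : Fin d → ℝ, Rᵀ.mulVec z = 0 ∧ ∃ k, 0 < z k := by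
    obtain ⟨k, hk⟩ := Function.ne_iff.mp hz'
    rcases lt_or_gt_of_ne hk with h | h
    · exact ⟨-z', by rw [Matrix.mulVec_neg, hRz', neg_zero], k, by simpa using h⟩
    · exact ⟨z', hRz', k, h⟩
  have : Nonempty (Fin d) := ⟨k0⟩
  obtain ⟨m, hm⟩ := Finite.exists_max (fun i => z i / y i)
  have hs : 0 < z m / y m := lt_of_lt_of_le (div_pos hk0 (hy k0)) (hm k0)
  set s := z m / y m with hsdef
  -- w = s y - z is nonnegative and vanishes at m
  have hw : s • y - z = 0 := by
    by_contra hne'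
    have := aux_pos R hA2 (s • y - z) (fun i => by
      have h := (div_le_iff₀ (hy i)).mp (hm i)
      simpa using h) hne' (fun j => by
      rw [Matrix.mulVec_sub, Matrix.mulVec_smul, hRz]
      simpa using mul_nonpos_of_nonneg_of_nonpos hs.le (hle j)) m
    simp [hsdef, div_mul_cancel₀ _ (hy m).ne'] at this
  refine ⟨y, hy, ?_⟩
  have h2 : s • Rᵀ.mulVec y = 0 := by
    rw [← Matrix.mulVec_smul, sub_eq_zero.mp hw, hRz]
  exact (smul_eq_zero.mp h2).resolve_left hs.ne'

theorem aux_fderiv {d : ℕ} (a : Fin d → ℝ) (x : Fin d → ℝ) (k : Fin d) :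
    DifferentiableAt ℝ (fun x : Fin d → ℝ => Real.exp (∑ i, a i * x i)) x ∧
    fderiv ℝ (fun x : Fin d → ℝ => Real.exp (∑ i, a i * x i)) x (Pi.single k 1)
      = a k * Real.exp (∑ i, a i * x i) := by
  have h : HasFDerivAt (fun x : Fin d → ℝ => ∑ i, a i * x i)
      (∑ i, a i • (ContinuousLinearMap.proj i : (Fin d → ℝ) →L[ℝ] ℝ)) x := by
    apply HasFDerivAt.fun_sum
    intro i _
    exact (ContinuousLinearMap.proj (R := ℝ) (φ := fun _ : Fin d => ℝ) i).hasFDerivAt.const_mul (a i)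
  refine ⟨h.exp.differentiableAt, ?_⟩
  rw [h.exp.fderiv]
  simp [Pi.single_apply, mul_comm]

theorem stmt_7 {d : ℕ} (hd : 2 ≤ d) (R : Matrix (Fin d) (Fin d) ℝ)
    (hdiag : ∀ i, R i i = 1) (hA1 : AssumptionA1 R) (hA2 : AssumptionA2 R)
    (hdet : R.det = 0)
    (S : Matrix (Fin d) (Fin d) ℝ) (hsymm : S.IsSymm) (hpd : S.PosDef)
    (μ : Fin d → ℝ) (hμ : ∀ i, 0 < μ i) :
    ∃ a : Fin d → ℝ, (∀ i, a i < 0) ∧ Rᵀ.mulVec a = 0 ∧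
      ∀ f : (Fin d → ℝ) → ℝ, (f = fun x => Real.exp (∑ i, a i * x i)) →
        -- (i) harmonicity for the generator (1/2) ∇·Σ∇ + μ·∇ on all of ℝ^d
        (∀ x : Fin d → ℝ,
          (1 / 2) * (∑ i, ∑ j, S i j *
              fderiv ℝ (fun y => fderiv ℝ f y (Pi.single j 1)) x (Pi.single i 1))
            + ∑ i, μ i * fderiv ℝ f x (Pi.single i 1) = 0) ∧
        -- (ii) Neumann condition on each face of the orthant
        (∀ i : Fin d, ∀ x : Fin d → ℝ, (∀ k, 0 ≤ x k) → x i = 0 →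
          ∑ k, R k i * fderiv ℝ f x (Pi.single k 1) = 0) ∧
        -- (iii) value 1 at the origin
        f 0 = 1 ∧
        -- (iv) decay at infinity within the orthant
        Filter.Tendsto f
          ((Filter.comap (fun x : Fin d → ℝ => ‖x‖) Filter.atTop) ⊓
            Filter.principal {x : Fin d → ℝ | ∀ k, 0 ≤ x k})
          (nhds 0) := by
  classical
  obtain ⟨y, hy, hRy⟩ := aux_kernel (by omega) R hA1 hA2 hdet
  have k0 : Fin d := ⟨0, by omega⟩
  have hne : Nonempty (Fin d) := ⟨k0⟩
  have hyne : y ≠ 0 := fun h => (hy k0).ne' (congrFun h k0)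
  set q : ℝ := ∑ i, ∑ j, S i j * (y i * y j) with hq
  have hqpos : 0 < q := by
    have h := hpd.dotProduct_mulVec_pos hyne
    have e : star y ⬝ᵥ S.mulVec y = q := by
      simp only [dotProduct, Matrix.mulVec, Finset.mul_sum, hq, star_trivial]
      exact Finset.sum_congr rfl fun _ _ => Finset.sum_congr rfl fun _ _ => by ring
    rwa [e] at h
  set p : ℝ := ∑ i, μ i * y i with hp
  have hppos : 0 < p := Finset.sum_pos (fun i _ => mul_pos (hμ i) (hy i)) Finset.univ_nonempty
  set t : ℝ := 2 * p / q with ht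
  have htpos : 0 < t := by positivity
  have htq : t * q = 2 * p := div_mul_cancel₀ _ hqpos.ne'
  obtain ⟨a, ha⟩ : ∃ a : Fin d → ℝ, a = (-t) • y := ⟨_, rfl⟩
  have hai : ∀ i, a i = -t * y i := fun i => by simp [ha]
  have hneg : ∀ i, a i < 0 := fun i => by
    rw [hai]; have := mul_pos htpos (hy i); linarith
  have hRa : Rᵀ.mulVec a = 0 := by rw [ha, Matrix.mulVec_smul, hRy, smul_zero]
  refine ⟨a, hneg, hRa, ?_⟩
  intro f hf
  have hd1 : ∀ x k, fderiv ℝ f x (Pi.single k 1) = a k * f x := by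
    intro x k; rw [hf]; exact (aux_fderiv a x k).2
  have hd2 : ∀ x j i, fderiv ℝ (fun y => fderiv ℝ f y (Pi.single j 1)) x (Pi.single i 1)
      = a j * (a i * f x) := by
    intro x j i
    simp only [hd1]
    rw [fderiv_const_mul (by rw [hf]; exact (aux_fderiv a x i).1)]
    simp [hd1]
  refine ⟨?_, ?_, ?_, ?_⟩
  · intro x
    simp only [hd2]
    simp only [hd1]
    have e1 : ∑ i, ∑ j, S i j * (a j * (a i * f x)) = t ^ 2 * q * f x := by
      simp only [hq, Finset.mul_sum, Finset.sum_mul, hai]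
      exact Finset.sum_congr rfl fun _ _ => Finset.sum_congr rfl fun _ _ => by ring
    have e2 : ∑ i, μ i * (a i * f x) = -t * p * f x := by
      simp only [hp, Finset.mul_sum, Finset.sum_mul, hai]
      exact Finset.sum_congr rfl fun _ _ => by ring
    rw [e1, e2]
    linear_combination (1 / 2) * t * f x * htq
  · intro i x _ _
    simp only [hd1]
    have := congrFun hRa i
    simp only [Matrix.mulVec, dotProduct, Matrix.transpose_apply, Pi.zero_apply] at this
    simp only [← mul_assoc]
    rw [← Finset.sum_mul, this, zero_mul]
  · simp [hf]
  · obtain ⟨m, hm⟩ := Finite.exists_max a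
    have hlim : Tendsto (fun x : Fin d → ℝ => Real.exp (a m * ‖x‖))
        ((Filter.comap (fun x : Fin d → ℝ => ‖x‖) Filter.atTop) ⊓
            Filter.principal {x : Fin d → ℝ | ∀ k, 0 ≤ x k}) (nhds 0) := by
      apply Real.tendsto_exp_atBot.comp
      exact (tendsto_comap.mono_left inf_le_left).const_mul_atTop_of_neg (hneg m)
    refine tendsto_of_tendsto_of_tendsto_of_le_of_le' tendsto_const_nhds hlim ?_ ?_
    · exact Eventually.of_forall fun x => by rw [hf]; positivity
    · refine Filter.Eventually.filter_mono inf_le_right ?_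
      rw [eventually_principal]
      intro x hx
      simp only [hf]
      apply Real.exp_le_exp.mpr
      have h1 : ‖x‖ ≤ ∑ i, x i := by
        rw [pi_norm_le_iff_of_nonneg (Finset.sum_nonneg fun i _ => hx i)]
        intro i
        rw [Real.norm_of_nonneg (hx i)]
        exact Finset.single_le_sum (fun j _ => hx j) (Finset.mem_univ i)
      calc ∑ i, a i * x i ≤ ∑ i, a m * x i :=
            Finset.sum_le_sum fun i _ => mul_le_mul_of_nonneg_right (hm i) (hx i)
        _ = a m * ∑ i, x i := by rw [Finset.mul_sum]
        _ ≤ a m * ‖x‖ := mul_le_mul_of_nonpos_left h1 (hneg m).le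
end
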